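/- Let μ be a probability measure on ℝ^H, ν a probability measure on ℝ^D, and Q : ℝ^H → ℝ^D a measurable map. Let T* : ℝ^D → ℝ^D be a measurable map such that the pushforward of Q_#μ under x' ↦ (x', T*(x')) is a coupling of (Q_#μ, ν) attaining the infimum inf_{π' ∈ Π(Q_#μ, ν)} ∫ ½‖x' − y‖² dπ'. Then G* = T* ∘ Q satisfies: the pushforward of μ under x ↦ (x, G*(x)) is a coupling of (μ, ν) attaining the infimum inf_{π ∈ Π(μ, ν)} ∫ ½‖Q(x) − y‖² dπ; that is, G* is an optimal transport map from μ to ν for the Q-embedded quadratic cost. -/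

import Mathlib

open MeasureTheory

/-- The embedded quadratic cost of a plan is the quadratic cost of its pushforward. -/
theorem lintegral_embedded_quadratic_cost {α : Type*} [MeasurableSpace α] {D : ℕ}
    {Q : α → EuclideanSpace ℝ (Fin D)} (hQ : Measurable Q)
    (π : Measure (α × EuclideanSpace ℝ (Fin D))) :
    ∫⁻ p, ENNReal.ofReal (1 / 2 * ‖Q p.1 - p.2‖ ^ 2) ∂π =
      ∫⁻ p, ENNReal.ofReal (1 / 2 * ‖p.1 - p.2‖ ^ 2) ∂(π.map (Prod.map Q id)) := by
  rw [lintegral_map (by fun_prop) (hQ.prodMap measurable_id)]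
  rfl

/-- Pushing the first factor of a coupling of `μ` and `ν` along `Q` gives a coupling of
`μ.map Q` and `ν`. -/
theorem marginals_map_prodMap_id {α β γ : Type*} [MeasurableSpace α] [MeasurableSpace β]
    [MeasurableSpace γ] {Q : α → γ} (hQ : Measurable Q) {μ : Measure α} {ν : Measure β}
    {π : Measure (α × β)} (hfst : π.map Prod.fst = μ) (hsnd : π.map Prod.snd = ν) :
    (π.map (Prod.map Q id)).map Prod.fst = μ.map Q ∧
      (π.map (Prod.map Q id)).map Prod.snd = ν := by
  have hQid : Measurable (Prod.map Q (id : β → β)) := hQ.prodMap measurable_id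
  constructor
  · rw [Measure.map_map measurable_fst hQid, ← hfst, Measure.map_map hQ measurable_fst]
    rfl
  · rw [Measure.map_map measurable_snd hQid, ← hsnd]
    rfl

/-- Lemma 4.2 (first claim): if `Tstar` is an optimal transport map from `Q_#μ` to `ν`
for the quadratic cost (i.e. the pushforward of `Q_#μ` under `x' ↦ (x', Tstar x')` is a
coupling of `(Q_#μ, ν)` attaining the infimum of the quadratic cost), then
`Gstar = Tstar ∘ Q` is an optimal transport map from `μ` to `ν` for the `Q`-embedded
quadratic cost. -/
theorem stmt_9 {H D : ℕ}
    (μ : Measure (EuclideanSpace ℝ (Fin H))) [IsProbabilityMeasure μ]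
    (ν : Measure (EuclideanSpace ℝ (Fin D))) [IsProbabilityMeasure ν]
    (Q : EuclideanSpace ℝ (Fin H) → EuclideanSpace ℝ (Fin D)) (hQ : Measurable Q)
    (Tstar : EuclideanSpace ℝ (Fin D) → EuclideanSpace ℝ (Fin D))
    (hTstar : Measurable Tstar)
    (hcplfst : ((μ.map Q).map fun x' => (x', Tstar x')).map Prod.fst = μ.map Q)
    (hcplsnd : ((μ.map Q).map fun x' => (x', Tstar x')).map Prod.snd = ν)
    (hopt : ∫⁻ p, ENNReal.ofReal (1 / 2 * ‖p.1 - p.2‖ ^ 2)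
        ∂((μ.map Q).map fun x' => (x', Tstar x')) =
      ⨅ (π' : Measure (EuclideanSpace ℝ (Fin D) × EuclideanSpace ℝ (Fin D)))
        (_ : π'.map Prod.fst = μ.map Q ∧ π'.map Prod.snd = ν),
        ∫⁻ p, ENNReal.ofReal (1 / 2 * ‖p.1 - p.2‖ ^ 2) ∂π') :
    (μ.map fun x => (x, Tstar (Q x))).map Prod.fst = μ ∧
    (μ.map fun x => (x, Tstar (Q x))).map Prod.snd = ν ∧
    ∫⁻ p, ENNReal.ofReal (1 / 2 * ‖Q p.1 - p.2‖ ^ 2)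
        ∂(μ.map fun x => (x, Tstar (Q x))) =
      ⨅ (π : Measure (EuclideanSpace ℝ (Fin H) × EuclideanSpace ℝ (Fin D)))
        (_ : π.map Prod.fst = μ ∧ π.map Prod.snd = ν),
        ∫⁻ p, ENNReal.ofReal (1 / 2 * ‖Q p.1 - p.2‖ ^ 2) ∂π := by
  have hgraph : Measurable fun x' => (x', Tstar x') := measurable_id.prodMk hTstar
  have hG : Measurable fun x => (x, Tstar (Q x)) := measurable_id.prodMk (hTstar.comp hQ)
  have hfst : (μ.map fun x => (x, Tstar (Q x))).map Prod.fst = μ := by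
    rw [Measure.map_map measurable_fst hG]
    exact Measure.map_id
  have hsnd : (μ.map fun x => (x, Tstar (Q x))).map Prod.snd = ν := by
    rw [Measure.map_map measurable_snd hG, ← hcplsnd, Measure.map_map measurable_snd hgraph,
      Measure.map_map (measurable_snd.comp hgraph) hQ]
    rfl
  refine ⟨hfst, hsnd, le_antisymm ?_ (iInf₂_le _ ⟨hfst, hsnd⟩)⟩
  have hpush := lintegral_embedded_quadratic_cost (D := D) hQ
  have hmap : (μ.map fun x => (x, Tstar (Q x))).map (Prod.map Q id) =
      (μ.map Q).map fun x' => (x', Tstar x') := by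
    rw [Measure.map_map (hQ.prodMap measurable_id) hG, Measure.map_map hgraph hQ]
    rfl
  rw [hpush, hmap, hopt]
  refine le_iInf₂ fun π hπ => ?_
  rw [hpush]
  exact iInf₂_le (π.map (Prod.map Q id)) (marginals_map_prodMap_id hQ hπ.1 hπ.2)
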